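/- There exist constants η₀ > 0 and C > 0 such that for every step size η ∈ (0, η₀) the following holds: if the initialization of the reparameterized GD dynamics satisfies |p₀| ≤ 1 and q₀ ∈ (c₀, 1-δ), then for every t ≥ 0 with q_t ≤ 1 one has |p_t| ≤ 4 and q_t ≤ q_{t+1} ≤ (1 + Cη²)·q_t. -/

import Mathlib

open Filter
open scoped Classical

noncomputable section

/-- Assumption (L): `l` is convex, even, 1-Lipschitz, twice differentiable, `l'' 0 = 1`. -/
def AssumptionL (l : ℝ → ℝ) : Prop :=
  ConvexOn ℝ Set.univ l ∧ (∀ x, l (-x) = l x) ∧ LipschitzWith 1 l ∧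
  (∀ x, DifferentiableAt ℝ l x) ∧ (∀ x, DifferentiableAt ℝ (deriv l) x) ∧
  deriv (deriv l) 0 = 1

/-- Assumption (R). -/
def AssumptionR (r : ℝ → ℝ) : Prop :=
  (∀ p, r (-p) = r p) ∧ ContDiff ℝ 1 r ∧ r 0 = 1 ∧ deriv r 0 = 0 ∧
  (∀ p, 0 < p → deriv r p < 0) ∧
  Tendsto r atTop (nhds 0) ∧ Tendsto r atBot (nhds 0)

/-- Assumption (R2). -/
def AssumptionR2 (r : ℝ → ℝ) : Prop :=
  ContDiff ℝ 4 r ∧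
  StrictAnti (fun z => deriv r z / (r z) ^ 2) ∧
  StrictAntiOn (fun z => z * deriv r z / r z) (Set.Ioi 0) ∧
  StrictMonoOn (fun z => z * deriv r z / r z) (Set.Iio 0) ∧
  StrictAntiOn (fun z => z * r z / deriv r z) (Set.Ioi 0) ∧
  StrictMonoOn (fun z => z * r z / deriv r z) (Set.Iio 0)

/-- The reparameterized GD dynamics for the two-layer fully-connected linear network. -/
def LinDyn (r : ℝ → ℝ) (η : ℝ) (p q : ℕ → ℝ) : Prop :=
  (∀ t, p (t + 1) = (1 - 2 * r (p t) / q t + η ^ 2 * (p t) ^ 2 * (r (p t)) ^ 2) * p t) ∧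
  (∀ t, q (t + 1) = (1 - η ^ 2 * (p t) ^ 2 * r (p t) * (2 * q t - r (p t)))⁻¹ * q t)

/-- `z₀ = sup {z : z r'(z)/r(z) ≥ -1/2}`. -/
def zZero (r : ℝ → ℝ) : ℝ := sSup {z : ℝ | z * deriv r z / r z ≥ -(1 / 2)}

/-- `c₀ = max {r(z₀), 1/2}`. -/
def cZero (r : ℝ → ℝ) : ℝ := max (r (zZero r)) (1 / 2)

/-- The function `h` of Theorem (EoS regime, Phase I). -/
def hFun (r : ℝ → ℝ) (p : ℝ) : ℝ :=
  if p = 0 then -(1 / (2 * deriv (deriv r) 0))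
  else -(1 / 2) * (p * (r p) ^ 3 / deriv r p + p ^ 2 * (r p) ^ 2)

/-- Assumption (R) forces `0 ≤ r ≤ 1`. -/
theorem r_bounds_aux (r : ℝ → ℝ) (hR : AssumptionR r) (x : ℝ) : 0 ≤ r x ∧ r x ≤ 1 := by
  obtain ⟨heven, hcd, h0, -, hneg, htop, -⟩ := hR
  have hanti : StrictAntiOn r (Set.Ici 0) := by
    apply strictAntiOn_of_deriv_neg (convex_Ici 0) hcd.continuous.continuousOn
    intro y hy
    rw [interior_Ici] at hy
    exact hneg y hy
  have key : ∀ y : ℝ, 0 ≤ y → 0 ≤ r y ∧ r y ≤ 1 := by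
    intro y hy
    constructor
    · apply le_of_tendsto htop
      filter_upwards [eventually_ge_atTop y] with z hz
      exact hanti.antitoneOn hy (le_trans hy hz) hz
    · rw [← h0]
      exact hanti.antitoneOn (Set.mem_Ici.mpr le_rfl) hy hy
  rcases le_total 0 x with h | h
  · exact key x h
  · rw [← heven x]
    exact key (-x) (by linarith)

/-- Boundedness of `x * r x`. -/
theorem xr_bound_aux (l r : ℝ → ℝ) (hL : AssumptionL l)
    (hrdef : ∀ x : ℝ, x ≠ 0 → r x = deriv l x / x) (x : ℝ) : |x * r x| ≤ 1 := by
  by_cases hx : x = 0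
  · simp [hx]
  · have h := norm_deriv_le_of_lipschitz (x₀ := x) hL.2.2.1
    rw [hrdef x hx, mul_div_cancel₀ _ hx]
    simpa using h

/-- One step of the dynamics: `q` stays positive and grows, and the invariant is preserved. -/
theorem step_aux (η p q ρ : ℝ) (hη : 0 < η) (hη4 : η < 1 / 4) (hρ0 : 0 ≤ ρ) (hρ1 : ρ ≤ 1)
    (ha : |p * ρ| ≤ 1) (hq : 1 / 2 < q) (hw : (η * p * q) ^ 2 < 1) :
    0 ≤ η ^ 2 * p ^ 2 * ρ * (2 * q - ρ) ∧
    0 < 1 - η ^ 2 * p ^ 2 * ρ * (2 * q - ρ) ∧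
    (η * ((1 - 2 * ρ / q + η ^ 2 * p ^ 2 * ρ ^ 2) * p) *
      ((1 - η ^ 2 * p ^ 2 * ρ * (2 * q - ρ))⁻¹ * q)) ^ 2 < 1 := by
  have hx0 : 0 ≤ η ^ 2 * p ^ 2 * ρ * (2 * q - ρ) :=
    mul_nonneg (by positivity) (by linarith)
  have hB : (η * (p * ρ)) ^ 2 < 1 := by
    have h1 : (p * ρ) ^ 2 ≤ 1 := (sq_le_one_iff_abs_le_one _).mpr ha
    have h2 : η ^ 2 < 1 := by nlinarith
    nlinarith [sq_nonneg (p * ρ), sq_nonneg η]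
  have hx1 : 0 < 1 - η ^ 2 * p ^ 2 * ρ * (2 * q - ρ) := by
    have e : 1 - η ^ 2 * p ^ 2 * ρ * (2 * q - ρ)
      = (η * p * q - η * (p * ρ)) ^ 2 + (1 - (η * p * q) ^ 2) := by ring
    rw [e]
    nlinarith [sq_nonneg (η * p * q - η * (p * ρ))]
  refine ⟨hx0, hx1, ?_⟩
  set d := 1 - η ^ 2 * p ^ 2 * ρ * (2 * q - ρ) with hd
  have e : η * ((1 - 2 * ρ / q + η ^ 2 * p ^ 2 * ρ ^ 2) * p) * (d⁻¹ * q)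
      = (η * p * q - 2 * (η * (p * ρ)) + (η * (p * ρ)) ^ 2 * (η * p * q)) / d := by
    have : q ≠ 0 := by linarith
    field_simp
  rw [e, div_pow, div_lt_one (by positivity)]
  have key : d ^ 2 - (η * p * q - 2 * (η * (p * ρ)) + (η * (p * ρ)) ^ 2 * (η * p * q)) ^ 2
      = (1 - (η * p * q) ^ 2) * (1 - (η * (p * ρ)) ^ 2) ^ 2 := by
    rw [hd]; ring
  have : 0 < (1 - (η * p * q) ^ 2) * (1 - (η * (p * ρ)) ^ 2) ^ 2 :=
    mul_pos (by linarith) (pow_pos (by linarith) 2)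
  linarith

/-- One step of the dynamics keeps `|p| ≤ 4` while `q ≤ 1`. -/
theorem p_step_aux (η p q ρ : ℝ) (hη : 0 < η) (hη4 : η < 1 / 4) (hρ0 : 0 ≤ ρ)
    (ha : |p * ρ| ≤ 1) (hq : 1 / 2 < q) (hq1 : q ≤ 1) (hp : |p| ≤ 4) :
    |(1 - 2 * ρ / q + η ^ 2 * p ^ 2 * ρ ^ 2) * p| ≤ 4 := by
  have hq0 : 0 < q := by linarith
  rw [abs_mul] at *
  rw [abs_of_nonneg hρ0] at ha
  rw [← sq_abs p]
  generalize |p| = P at *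
  by_cases hP : P < 0
  · nlinarith [abs_nonneg (1 - 2 * ρ / q + η ^ 2 * P ^ 2 * ρ ^ 2)]
  push Not at hP
  have hη2 : η ^ 2 ≤ 1 / 16 := by nlinarith
  have hu : 2 * ρ ≤ 2 * ρ / q := by
    rw [le_div_iff₀ hq0]; nlinarith
  have hu2 : 2 * ρ / q ≤ 4 * ρ := by
    rw [div_le_iff₀ hq0]; nlinarith
  have hPρ : 0 ≤ P * ρ := mul_nonneg hP hρ0
  have h1 : η ^ 2 * P ^ 2 * ρ ^ 2 ≤ 2 * ρ := by
    have h2 : η ^ 2 * P ^ 2 * ρ ^ 2 = η ^ 2 * (P * (P * ρ)) * ρ := by ring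
    rw [h2]
    have h3 : P * (P * ρ) ≤ 4 := by nlinarith
    have h4 : 0 ≤ P * (P * ρ) := by positivity
    have h5 : η ^ 2 * (P * (P * ρ)) ≤ 2 := by nlinarith [sq_nonneg η]
    exact mul_le_mul_of_nonneg_right h5 hρ0
  have h0 : 0 ≤ η ^ 2 * P ^ 2 * ρ ^ 2 := by positivity
  have : |1 - 2 * ρ / q + η ^ 2 * P ^ 2 * ρ ^ 2| * P
      = |(1 - 2 * ρ / q + η ^ 2 * P ^ 2 * ρ ^ 2) * P| := by
    rw [abs_mul, abs_of_nonneg hP]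
  rw [this, abs_le]
  constructor <;> nlinarith

/-- Boundedness of `p_t` and slow monotone growth of `q_t` in the EoS regime. -/
theorem eos_pq_bounds_linear (l r : ℝ → ℝ) (δ : ℝ)
    (hL : AssumptionL l)
    (hr0 : r 0 = 1) (hrdef : ∀ x : ℝ, x ≠ 0 → r x = deriv l x / x)
    (hR : AssumptionR r)
    (hδ : δ ∈ Set.Ioo 0 (1 - cZero r)) :
    ∃ η₀ > (0 : ℝ), ∃ C > (0 : ℝ),
      ∀ η : ℝ, 0 < η → η < η₀ →
        ∀ p q : ℕ → ℝ, LinDyn r η p q →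
          |p 0| ≤ 1 → q 0 ∈ Set.Ioo (cZero r) (1 - δ) →
          ∀ t : ℕ, q t ≤ 1 →
            |p t| ≤ 4 ∧ q t ≤ q (t + 1) ∧ q (t + 1) ≤ (1 + C * η ^ 2) * q t := by
  refine ⟨1 / 4, by norm_num, 16, by norm_num, ?_⟩
  intro η hη hη4 p q hdyn hp0 hq0 
  obtain ⟨hpd, hqd⟩ := hdyn
  have hρ := r_bounds_aux r hR
  have ha := xr_bound_aux l r hL hrdef
  have hc : (1 / 2 : ℝ) ≤ cZero r := le_max_right _ _
  have hqhalf : 1 / 2 < q 0 := lt_of_le_of_lt hc hq0.1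
  have hqone : q 0 < 1 := by linarith [hq0.2, hδ.1]
  have inv : ∀ t, 1 / 2 < q t ∧ (η * p t * q t) ^ 2 < 1 ∧ q t ≤ q (t + 1) := by
    have mono : ∀ t, 1 / 2 < q t → (η * p t * q t) ^ 2 < 1 → q t ≤ q (t + 1) := by
      intro t h1 h2
      obtain ⟨s1, s2, -⟩ := step_aux η (p t) (q t) (r (p t)) hη hη4 (hρ _).1 (hρ _).2 (ha _) h1 h2
      rw [hqd t]
      exact le_mul_of_one_le_left (by linarith) ((one_le_inv₀ s2).mpr (by linarith))
    intro t
    induction t with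
    | zero =>
      have : (η * p 0 * q 0) ^ 2 < 1 := by
        rw [sq_lt_one_iff_abs_lt_one, abs_mul, abs_mul, abs_of_pos hη,
          abs_of_pos (show 0 < q 0 by linarith)]
        have h1 : η * |p 0| ≤ 1 / 4 := by nlinarith [abs_nonneg (p 0)]
        have h2 : 0 ≤ η * |p 0| := by positivity
        nlinarith
      exact ⟨hqhalf, this, mono 0 hqhalf this⟩
    | succ t ih =>
      obtain ⟨h1, h2, h3⟩ := ih
      obtain ⟨-, -, s3⟩ := step_aux η (p t) (q t) (r (p t)) hη hη4 (hρ _).1 (hρ _).2 (ha _) h1 h2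
      have h4 : 1 / 2 < q (t + 1) := by linarith
      have h5 : (η * p (t + 1) * q (t + 1)) ^ 2 < 1 := by
        rw [hpd t, hqd t]; exact s3
      exact ⟨h4, h5, mono _ h4 h5⟩
  have hp : ∀ t, q t ≤ 1 → |p t| ≤ 4 := by
    intro t
    induction t with
    | zero => intro _; linarith
    | succ t ih =>
      intro h
      have h1 : q t ≤ 1 := le_trans (inv t).2.2 h
      rw [hpd t]
      exact p_step_aux η (p t) (q t) (r (p t)) hη hη4 (hρ _).1 (ha _) (inv t).1 h1 (ih h1)
  intro t ht
  obtain ⟨h1, h2, h3⟩ := inv t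
  refine ⟨hp t ht, h3, ?_⟩
  obtain ⟨s1, s2, -⟩ := step_aux η (p t) (q t) (r (p t)) hη hη4 (hρ _).1 (hρ _).2 (ha _) h1 h2
  have hx : η ^ 2 * p t ^ 2 * r (p t) * (2 * q t - r (p t)) ≤ 8 * η ^ 2 := by
    have e1 : p t ^ 2 * r (p t) ≤ 4 := by
      have e2 : p t ^ 2 * r (p t) = p t * (p t * r (p t)) := by ring
      rw [e2]
      calc p t * (p t * r (p t)) ≤ |p t * (p t * r (p t))| := le_abs_self _
        _ = |p t| * |p t * r (p t)| := abs_mul _ _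
        _ ≤ 4 * 1 := mul_le_mul (hp t ht) (ha _) (abs_nonneg _) (by norm_num)
        _ = 4 := by norm_num
    have e3 : 0 ≤ p t ^ 2 * r (p t) := mul_nonneg (sq_nonneg _) (hρ _).1
    have e4 : p t ^ 2 * r (p t) * (2 * q t - r (p t)) ≤ 4 * 2 :=
      mul_le_mul e1 (by linarith [(hρ (p t)).1]) (by linarith [(hρ (p t)).2]) (by norm_num)
    nlinarith [sq_nonneg η]
  rw [hqd t]
  apply mul_le_mul_of_nonneg_right _ (by linarith)
  rw [inv_le_iff_one_le_mul₀ s2]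
  have hη2 : η ^ 2 ≤ 1 / 16 := by nlinarith
  nlinarith [sq_nonneg η]
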